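/- Let k ⊆ E ⊆ L ⊆ k̄ with L/E a finite extension. Then L/E is cyclotomic coradical if and only if it is separable, radical, and [L : E] = p^m for some m ∈ ℕ, where p = char k. -/

import Mathlib

open Polynomial IntermediateField

noncomputable section

variable (Fq : Type) [Field Fq] [Fintype Fq]

/-- A fixed algebraic closure of the rational function field `k = Fq(T)`. -/
abbrev Kbar := AlgebraicClosure (RatFunc Fq)

/-- The Carlitz action of `T`: the `Fq`-linear map `u ↦ T•u + u^q`. -/
def carlitzT : Module.End Fq (Kbar Fq) where
  toFun u := algebraMap (RatFunc Fq) (Kbar Fq) RatFunc.X * u + u ^ Fintype.card Fq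
  map_add' u v := by
    obtain ⟨n, hp, hcard⟩ := FiniteField.card Fq (ringChar Fq)
    haveI : Fact (ringChar Fq).Prime := ⟨hp⟩
    haveI : CharP (Kbar Fq) (ringChar Fq) :=
      charP_of_injective_algebraMap (algebraMap Fq (Kbar Fq)).injective _
    show algebraMap (RatFunc Fq) (Kbar Fq) RatFunc.X * (u + v) + (u + v) ^ Fintype.card Fq =
      (algebraMap (RatFunc Fq) (Kbar Fq) RatFunc.X * u + u ^ Fintype.card Fq) +
        (algebraMap (RatFunc Fq) (Kbar Fq) RatFunc.X * v + v ^ Fintype.card Fq)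
    rw [hcard, add_pow_char_pow]
    ring
  map_smul' c u := by
    simp only [RingHom.id_apply, smul_add, mul_smul_comm, _root_.smul_pow, FiniteField.pow_card]

/-- The Carlitz module: the `Fq`-algebra morphism `Fq[T] → End_{Fq}(k̄)`
determined by `T ↦ (u ↦ T·u + u^q)`. -/
def carlitzHom : Polynomial Fq →ₐ[Fq] Module.End Fq (Kbar Fq) :=
  aeval (carlitzT Fq)

/-- The Carlitz action `C_a(u)`. -/
def carlitz (a : Polynomial Fq) (u : Kbar Fq) : Kbar Fq :=
  carlitzHom Fq a u

/-- `Λ_a = {u ∈ k̄ : C_a(u) = 0}`. -/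
def Lambda (a : Polynomial Fq) : Set (Kbar Fq) := {u | carlitz Fq a u = 0}

/-- The Carlitz torsion `μ(L)` of an intermediate field `L`. -/
def carlitzTorsion (L : IntermediateField (RatFunc Fq) (Kbar Fq)) : Set (Kbar Fq) :=
  {u | u ∈ L ∧ ∃ a : Polynomial Fq, a ≠ 0 ∧ carlitz Fq a u = 0}

/-- `DrinT(L/K) = {u ∈ L : C_m(u) ∈ K for some nonzero m}`. -/
def DrinT (K L : IntermediateField (RatFunc Fq) (Kbar Fq)) : Set (Kbar Fq) :=
  {u | u ∈ L ∧ ∃ m : Polynomial Fq, m ≠ 0 ∧ carlitz Fq m u ∈ K}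

/-- `L/K` is radical: `L = K(X)` for some `X ⊆ DrinT(L/K)`. -/
def IsRadicalC (K L : IntermediateField (RatFunc Fq) (Kbar Fq)) : Prop :=
  ∃ X ⊆ DrinT Fq K L, L = adjoin (RatFunc Fq) ((K : Set (Kbar Fq)) ∪ X)

/-- `L/K` is pure: every root in `L` of some `C_m`, `m` irreducible, lies in `K`. -/
def IsPureC (K L : IntermediateField (RatFunc Fq) (Kbar Fq)) : Prop :=
  ∀ m : Polynomial Fq, Irreducible m → ∀ u ∈ L, carlitz Fq m u = 0 → u ∈ K

/-- `L/K` is separable: every element of `L` is separable over `K`. -/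
def IsSeparableC (K L : IntermediateField (RatFunc Fq) (Kbar Fq)) : Prop :=
  ∀ u ∈ L, IsSeparable K u

/-- `L/K` is cyclotomic coradical: radical, separable and pure. -/
def IsCycloCoradicalC (K L : IntermediateField (RatFunc Fq) (Kbar Fq)) : Prop :=
  IsRadicalC Fq K L ∧ IsSeparableC Fq K L ∧ IsPureC Fq K L


section Galois

variable {K L : Type*} [Field K] [Field L] [Algebra K L] [Normal K L]

/-- The Galois orbit of a separable element `x` has `[K(x) : K]` elements. -/
theorem ncard_orbit_algEquiv {x : L} (hx : IsSeparable K x) :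
    (MulAction.orbit (L ≃ₐ[K] L) x).ncard = Module.finrank K K⟮x⟯ := by
  have hint : IsIntegral K x := hx.isIntegral
  have horb : MulAction.orbit (L ≃ₐ[K] L) x = (minpoly K x).rootSet L := by
    ext y
    rw [← isConjRoot_iff_mem_minpoly_rootSet hint, IsConjRoot.comm]
    exact isConjRoot_iff_orbitRel.symm
  rw [horb, adjoin.finrank hint, ← Nat.card_coe_set_eq, Nat.card_eq_fintype_card,
    card_rootSet_eq_natDegree hx (Normal.splits inferInstance x)]

end Galois

theorem relfinrank_restrictScalars_adjoin {k F : Type*} [Field k] [Field F] [Algebra k F]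
    (K : IntermediateField k F) (u : F) :
    relfinrank K (K⟮u⟯.restrictScalars k) = Module.finrank K K⟮u⟯ :=
  relfinrank_eq_finrank_of_le fun x hx => K⟮u⟯.algebraMap_mem ⟨x, hx⟩

theorem restrictScalars_adjoin_simple_le_iff {k F : Type*} [Field k] [Field F] [Algebra k F]
    {K M : IntermediateField k F} {u : F} :
    K⟮u⟯.restrictScalars k ≤ M ↔ K ≤ M ∧ u ∈ M := by
  constructor
  · exact fun h => ⟨fun x hx => h (K⟮u⟯.algebraMap_mem ⟨x, hx⟩), h (mem_adjoin_simple_self K u)⟩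
  · rintro ⟨hK, hu⟩
    change K⟮u⟯ ≤ extendScalars hK
    rwa [adjoin_simple_le_iff]

/-- The polynomial `C_{T^n}(X)`. -/
def carlitzIter : ℕ → (RatFunc Fq)[X]
  | 0 => X
  | n + 1 => C RatFunc.X * carlitzIter n + carlitzIter n ^ Fintype.card Fq

/-- The polynomial `C_a(X)`. -/
def carlitzPoly (a : Fq[X]) : (RatFunc Fq)[X] :=
  ∑ n ∈ Finset.range (a.natDegree + 1),
    C (algebraMap Fq (RatFunc Fq) (a.coeff n)) * carlitzIter Fq n

theorem aeval_carlitzIter (n : ℕ) (u : Kbar Fq) :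
    aeval u (carlitzIter Fq n) = (carlitzT Fq ^ n) u := by
  induction n with
  | zero => simp [carlitzIter]
  | succ n ih =>
    rw [pow_succ', Module.End.mul_apply, carlitzIter, map_add, map_mul, map_pow, ih, aeval_C]
    rfl

theorem aeval_carlitzPoly (a : Fq[X]) (u : Kbar Fq) :
    aeval u (carlitzPoly Fq a) = carlitz Fq a u := by
  rw [carlitzPoly, map_sum, carlitz, carlitzHom, aeval_eq_sum_range, LinearMap.sum_apply]
  refine Finset.sum_congr rfl fun n _ => ?_
  rw [map_mul, aeval_C, aeval_carlitzIter, LinearMap.smul_apply, Algebra.smul_def,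
    ← IsScalarTower.algebraMap_apply]

theorem derivative_carlitzIter (n : ℕ) :
    derivative (carlitzIter Fq n) = C (RatFunc.X ^ n) := by
  induction n with
  | zero => simp [carlitzIter]
  | succ n ih =>
    have hq : (Fintype.card Fq : RatFunc Fq) = 0 := by
      rw [← map_natCast (algebraMap Fq (RatFunc Fq)), Nat.cast_card_eq_zero, map_zero]
    simp [carlitzIter, ih, derivative_pow, hq, pow_succ']

theorem derivative_carlitzPoly (a : Fq[X]) :
    derivative (carlitzPoly Fq a) = C (algebraMap Fq[X] (RatFunc Fq) a) := by
  conv_rhs => rw [a.as_sum_range_C_mul_X_pow]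
  simp only [carlitzPoly, derivative_C_mul, derivative_carlitzIter, map_sum,
    map_mul, map_pow, RatFunc.algebraMap_X, RatFunc.algebraMap_C]
  rfl

theorem natDegree_carlitzIter_le (n : ℕ) :
    (carlitzIter Fq n).natDegree ≤ Fintype.card Fq ^ n := by
  induction n with
  | zero => simp [carlitzIter]
  | succ n ih =>
    refine natDegree_add_le_of_degree_le ?_ ?_
    · exact (natDegree_C_mul_le _ _).trans
        (ih.trans (Nat.pow_le_pow_right Fintype.card_pos n.le_succ))
    · rw [pow_succ']
      exact natDegree_pow_le_of_le _ ih

theorem natDegree_carlitzPoly_le (a : Fq[X]) :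
    (carlitzPoly Fq a).natDegree ≤ Fintype.card Fq ^ a.natDegree := by
  refine natDegree_sum_le_of_forall_le _ _ fun n hn => (natDegree_C_mul_le _ _).trans
    ((natDegree_carlitzIter_le Fq n).trans (Nat.pow_le_pow_right Fintype.card_pos ?_))
  exact Nat.lt_succ_iff.mp (Finset.mem_range.mp hn)

variable {Fq}

theorem carlitzPoly_ne_zero {a : Fq[X]} (ha : a ≠ 0) : carlitzPoly Fq a ≠ 0 := fun h => by
  have := derivative_carlitzPoly Fq a
  rw [h, derivative_zero, eq_comm, C_eq_zero] at this
  exact ha ((map_eq_zero_iff _ (IsFractionRing.injective Fq[X] (RatFunc Fq))).mp this)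

theorem carlitz_mul (a b : Fq[X]) (u : Kbar Fq) :
    carlitz Fq (a * b) u = carlitz Fq a (carlitz Fq b u) := by
  simp [carlitz]

theorem carlitz_add_left (a b : Fq[X]) (u : Kbar Fq) :
    carlitz Fq (a + b) u = carlitz Fq a u + carlitz Fq b u := by
  simp [carlitz]

theorem carlitz_sub_left (a b : Fq[X]) (u : Kbar Fq) :
    carlitz Fq (a - b) u = carlitz Fq a u - carlitz Fq b u := by
  simp [carlitz]

theorem carlitz_sub (a : Fq[X]) (u v : Kbar Fq) :
    carlitz Fq a (u - v) = carlitz Fq a u - carlitz Fq a v := by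
  simp [carlitz]

theorem carlitz_zero (a : Fq[X]) : carlitz Fq a 0 = 0 := by
  simp [carlitz]

theorem carlitz_one (u : Kbar Fq) : carlitz Fq 1 u = u := by
  simp [carlitz]

theorem carlitz_mem (K : IntermediateField (RatFunc Fq) (Kbar Fq)) (a : Fq[X]) {u : Kbar Fq}
    (hu : u ∈ K) : carlitz Fq a u ∈ K := by
  rw [← aeval_carlitzPoly, show aeval u (carlitzPoly Fq a) = _ from K.aeval_coe ⟨u, hu⟩ _]
  exact SetLike.coe_mem _

theorem carlitz_algEquiv {K : IntermediateField (RatFunc Fq) (Kbar Fq)}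
    (g : Kbar Fq ≃ₐ[K] Kbar Fq) (a : Fq[X]) (u : Kbar Fq) :
    g (carlitz Fq a u) = carlitz Fq a (g u) := by
  rw [← aeval_carlitzPoly, ← aeval_carlitzPoly]
  exact (aeval_algHom_apply (g.restrictScalars (RatFunc Fq)).toAlgHom u _).symm

/-- A Carlitz division point of a point of `K` is separable over `K`. -/
theorem isSeparable_of_carlitz_mem {K : IntermediateField (RatFunc Fq) (Kbar Fq)} {a : Fq[X]}
    (ha : a ≠ 0) {u : Kbar Fq} (hu : carlitz Fq a u ∈ K) : IsSeparable K u := by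
  let f : K[X] := (carlitzPoly Fq a).map (algebraMap (RatFunc Fq) K) - C ⟨_, hu⟩
  have hder : derivative f = C (algebraMap (RatFunc Fq) K (algebraMap Fq[X] (RatFunc Fq) a)) := by
    simp [f, derivative_map, derivative_carlitzPoly]
  have hunit : IsUnit (derivative f) := by
    rw [hder, isUnit_C, isUnit_iff_ne_zero]
    simpa using ha
  have hsep : f.Separable := by
    obtain ⟨v, hv⟩ := hunit.exists_left_inv
    exact ⟨0, v, by rw [zero_mul, zero_add, hv]⟩
  refine hsep.of_dvd (minpoly.dvd K u ?_)
  rw [map_sub, aeval_map_algebraMap, aeval_carlitzPoly, aeval_C]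
  exact sub_self _

theorem finite_Lambda {a : Fq[X]} (ha : a ≠ 0) : (Lambda Fq a).Finite := by
  refine ((carlitzPoly Fq a).rootSet_finite (Kbar Fq)).subset fun u hu => ?_
  rw [mem_rootSet, aeval_carlitzPoly]
  exact ⟨carlitzPoly_ne_zero ha, hu⟩

theorem ncard_Lambda_le {a : Fq[X]} (ha : a ≠ 0) :
    (Lambda Fq a).ncard ≤ Fintype.card Fq ^ a.natDegree := by
  refine le_trans ?_ (natDegree_carlitzPoly_le Fq a)
  refine le_trans (Set.ncard_le_ncard (t := (carlitzPoly Fq a).rootSet (Kbar Fq)) ?_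
    (rootSet_finite _ _)) (ncard_rootSet_le _ _)
  intro u hu
  rw [mem_rootSet, aeval_carlitzPoly]
  exact ⟨carlitzPoly_ne_zero ha, hu⟩

/-- The annihilator of a nonzero `m`-torsion point, `m` irreducible, is `(m)`. -/
theorem dvd_of_carlitz_eq_zero {m : Fq[X]} (hm : Irreducible m) {u : Kbar Fq} (hu0 : u ≠ 0)
    (hu : carlitz Fq m u = 0) {c : Fq[X]} (hc : carlitz Fq c u = 0) : m ∣ c := by
  by_contra h
  obtain ⟨x, y, hxy⟩ := hm.coprime_iff_not_dvd.mpr h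
  apply hu0
  rw [← carlitz_one u, ← hxy, carlitz_add_left, carlitz_mul, carlitz_mul, hu, hc, carlitz_zero,
    carlitz_zero, add_zero]

/-- For `m` irreducible, any nonzero `m`-torsion point generates the `m`-torsion. -/
theorem exists_carlitz_eq {m : Fq[X]} (hm : Irreducible m) {u v : Kbar Fq} (hu0 : u ≠ 0)
    (hu : carlitz Fq m u = 0) (hv : carlitz Fq m v = 0) : ∃ c : Fq[X], carlitz Fq c u = v := by
  let φ : degreeLT Fq m.natDegree → Kbar Fq := fun c => carlitz Fq c u
  have hinj : Function.Injective φ := fun c d hcd => by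
    have hdvd : m ∣ (c - d : Fq[X]) := dvd_of_carlitz_eq_zero hm hu0 hu <| by
      rw [carlitz_sub_left, sub_eq_zero]
      exact hcd
    have hdeg : (c - d : Fq[X]).degree < m.degree := by
      rw [degree_eq_natDegree hm.ne_zero]
      exact mem_degreeLT.mp (c - d).2
    exact Subtype.ext (sub_eq_zero.mp (eq_zero_of_dvd_of_degree_lt hdvd hdeg))
  have hsub : Set.range φ ⊆ Lambda Fq m := by
    rintro _ ⟨c, rfl⟩
    change carlitz Fq m (carlitz Fq c u) = 0
    rw [← carlitz_mul, mul_comm, carlitz_mul, hu, carlitz_zero]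
  have hcard : (Set.range φ).ncard = Fintype.card Fq ^ m.natDegree := by
    rw [← Set.image_univ, Set.ncard_image_of_injective _ hinj, Set.ncard_univ,
      Nat.card_congr (degreeLTEquiv Fq m.natDegree).toEquiv]
    simp
  have heq := Set.eq_of_subset_of_ncard_le hsub (hcard ▸ ncard_Lambda_le hm.ne_zero)
    (finite_Lambda hm.ne_zero)
  have hmem : v ∈ Set.range φ := heq ▸ hv
  obtain ⟨c, hc⟩ := hmem
  exact ⟨c, hc⟩

section Degree

variable {K : IntermediateField (RatFunc Fq) (Kbar Fq)}

theorem carlitz_algEquiv_sub_self {a : Fq[X]} {u : Kbar Fq} (hu : carlitz Fq a u ∈ K)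
    (g : Kbar Fq ≃ₐ[K] Kbar Fq) : carlitz Fq a (g u - u) = 0 := by
  rw [carlitz_sub, ← carlitz_algEquiv, sub_eq_zero]
  exact g.commutes ⟨_, hu⟩

theorem carlitz_algEquiv_eq_zero {a : Fq[X]} {u : Kbar Fq} (hu : carlitz Fq a u = 0)
    (g : Kbar Fq ≃ₐ[K] Kbar Fq) : carlitz Fq a (g u) = 0 := by
  rw [← carlitz_algEquiv, hu, map_zero]

/-- Automorphisms act on the `m`-torsion, `m` irreducible, through scalars. -/
theorem exists_forall_algEquiv_eq_carlitz {m : Fq[X]} (hm : Irreducible m)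
    (g : Kbar Fq ≃ₐ[K] Kbar Fq) :
    ∃ c : Fq[X], ∀ v, carlitz Fq m v = 0 → g v = carlitz Fq c v := by
  by_cases h : ∃ u : Kbar Fq, u ≠ 0 ∧ carlitz Fq m u = 0
  · obtain ⟨u, hu0, hu⟩ := h
    obtain ⟨c, hc⟩ := exists_carlitz_eq hm hu0 hu (carlitz_algEquiv_eq_zero hu g)
    refine ⟨c, fun v hv => ?_⟩
    obtain ⟨b, rfl⟩ := exists_carlitz_eq hm hu0 hu hv
    rw [carlitz_algEquiv, ← hc, ← carlitz_mul, ← carlitz_mul, mul_comm]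
  · push Not at h
    refine ⟨1, fun v hv => ?_⟩
    have hv0 : v = 0 := by_contra fun hv0 => h v hv0 hv
    rw [carlitz_one, hv0, map_zero]

theorem exists_algEquiv_ne {F : Type*} {M : Type*} [Field F] [Field M] [Algebra F M] [Normal F M]
    {x : M} (hx : IsSeparable F x) (hmem : x ∉ (⊥ : IntermediateField F M)) :
    ∃ g : M ≃ₐ[F] M, g x ≠ x := by
  obtain ⟨y, hne, hy⟩ := (notMem_iff_exists_ne_and_isConjRoot (K := F) hx
    (Normal.splits inferInstance x)).mp hmem
  obtain ⟨g, hg⟩ := hy.symm.exists_algEquiv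
  exact ⟨g, hg ▸ hne.symm⟩

theorem algEquiv_pow_apply_eq_carlitz {c : Fq[X]} {u : Kbar Fq} {g : Kbar Fq ≃ₐ[K] Kbar Fq}
    (hg : g u = carlitz Fq c u) (n : ℕ) : (g ^ n) u = carlitz Fq (c ^ n) u := by
  induction n with
  | zero => simp [carlitz_one]
  | succ n ih =>
    rw [pow_succ, AlgEquiv.mul_apply, hg, carlitz_algEquiv, ih, ← carlitz_mul, pow_succ, mul_comm]

variable (p : ℕ) [Fact p.Prime] [CharP Fq p]

/-- An `m`-torsion point, `m` irreducible, of `p`-power degree over `K` lies in `K`. -/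
theorem mem_of_finrank_adjoin_eq_pow {m : Fq[X]} (hm : Irreducible m) {u : Kbar Fq}
    (hu : carlitz Fq m u = 0) {j : ℕ} (hj : Module.finrank K K⟮u⟯ = p ^ j) : u ∈ K := by
  by_cases hu0 : u = 0
  · exact hu0 ▸ zero_mem K
  have hsep : IsSeparable K u := isSeparable_of_carlitz_mem hm.ne_zero (hu ▸ zero_mem K)
  let G := Kbar Fq ≃ₐ[K] Kbar Fq
  have hscal (g : G) := exists_carlitz_eq hm hu0 hu (carlitz_algEquiv_eq_zero hu g)
  have hidx : (MulAction.stabilizer G u).index = p ^ j := by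
    rw [MulAction.index_stabilizer, ncard_orbit_algEquiv hsep, hj]
  have hnormal : (MulAction.stabilizer G u).Normal := by
    refine ⟨fun h hh g => ?_⟩
    rw [MulAction.mem_stabilizer_iff, mul_smul, mul_smul, ← eq_inv_smul_iff]
    obtain ⟨c, hc⟩ := hscal g⁻¹
    change h (g⁻¹ u) = g⁻¹ u
    rw [← hc, carlitz_algEquiv]
    exact congrArg _ hh
  by_contra hmem
  obtain ⟨g, hg⟩ := exists_algEquiv_ne hsep
    (fun h => hmem (by obtain ⟨x, rfl⟩ := mem_bot.mp h; exact x.2))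
  obtain ⟨c, hc⟩ := hscal g
  have hpow : (g ^ p ^ j) u = u :=
    MulAction.mem_stabilizer_iff.mp (hidx ▸ Subgroup.pow_index_mem (MulAction.stabilizer G u) g)
  have hdvd : m ∣ (c - 1) ^ p ^ j := by
    refine dvd_of_carlitz_eq_zero hm hu0 hu ?_
    rw [sub_pow_char_pow, one_pow, carlitz_sub_left, carlitz_one,
      ← algEquiv_pow_apply_eq_carlitz hc.symm, hpow, sub_self]
  obtain ⟨b, hb⟩ := hm.prime.dvd_of_dvd_pow hdvd
  refine hg (sub_eq_zero.mp ?_)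
  nth_rw 2 [← carlitz_one u]
  rw [← hc, ← carlitz_sub_left, hb, mul_comm, carlitz_mul, hu, carlitz_zero]

/-- If `C_m(u) ∈ K` with `m` irreducible, and the `m`-torsion of `K(u)` lies in `K`, then
`K(u)/K` has `p`-power degree. -/
theorem exists_finrank_adjoin_eq_pow {m : Fq[X]} (hm : Irreducible m) {u : Kbar Fq}
    (hu : carlitz Fq m u ∈ K) (hpure : ∀ v ∈ K⟮u⟯, carlitz Fq m v = 0 → v ∈ K) :
    ∃ j : ℕ, Module.finrank K K⟮u⟯ = p ^ j := by
  have hsep : IsSeparable K u := isSeparable_of_carlitz_mem hm.ne_zero hu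
  let G := Kbar Fq ≃ₐ[K] Kbar Fq
  let S : AddSubgroup (Kbar Fq) :=
    { carrier := {v | ∃ g : G, g u = u + v ∧ ∀ w, carlitz Fq m w = 0 → g w = w}
      zero_mem' := ⟨1, (add_zero u).symm, fun w _ => rfl⟩
      add_mem' := by
        rintro v v' ⟨g, hg, hgt⟩ ⟨g', hg', hgt'⟩
        have hv' : carlitz Fq m v' = 0 := by
          rw [← add_sub_cancel_left u v', ← hg']
          exact carlitz_algEquiv_sub_self hu g'
        refine ⟨g * g', ?_, fun w hw => ?_⟩
        · rw [AlgEquiv.mul_apply, hg', map_add, hg, hgt v' hv', add_assoc]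
        · rw [AlgEquiv.mul_apply, hgt' w hw, hgt w hw]
      neg_mem' := by
        rintro v ⟨g, hg, hgt⟩
        have hv : carlitz Fq m v = 0 := by
          rw [← add_sub_cancel_left u v, ← hg]
          exact carlitz_algEquiv_sub_self hu g
        refine ⟨g⁻¹, g.injective ?_, fun w hw => g.injective ?_⟩
        · rw [← AlgEquiv.mul_apply, mul_inv_cancel, AlgEquiv.one_apply, map_add, map_neg, hg,
            hgt v hv, add_neg_cancel_right]
        · rw [← AlgEquiv.mul_apply, mul_inv_cancel, AlgEquiv.one_apply, hgt w hw] }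
  have hS : ∀ v ∈ S, carlitz Fq m v = 0 := by
    rintro v ⟨g, hg, -⟩
    rw [← add_sub_cancel_left u v, ← hg]
    exact carlitz_algEquiv_sub_self hu g
  have hSfin : Finite S := (finite_Lambda hm.ne_zero).subset hS
  have horb_mem (g : G) : g u - u ∈ S := by
    by_cases hall : ∀ w, carlitz Fq m w = 0 → w ∈ K
    · exact ⟨g, (add_sub_cancel _ _).symm, fun w hw => g.commutes ⟨w, hall w hw⟩⟩
    push Not at hall
    obtain ⟨w, hw, hwK⟩ := hall
    have hw0 : w ≠ 0 := fun h => hwK (h ▸ zero_mem K)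
    obtain ⟨h, hhu, hhw⟩ : ∃ h : G, h u = u ∧ h w ≠ w := by
      have hwsep : IsSeparable K⟮u⟯ w :=
        isSeparable_of_carlitz_mem (K := K⟮u⟯.restrictScalars (RatFunc Fq)) hm.ne_zero
          (hw ▸ zero_mem _)
      obtain ⟨h, hh⟩ := exists_algEquiv_ne hwsep fun hb => hwK (hpure w (by
        obtain ⟨x, rfl⟩ := mem_bot.mp hb
        exact x.2) hw)
      exact ⟨h.restrictScalars K, h.commutes ⟨u, mem_adjoin_simple_self K u⟩, hh⟩
    have hcomm (g g' : G) {v : Kbar Fq} (hv : carlitz Fq m v = 0) : g (g' v) = g' (g v) := by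
      obtain ⟨c, hc⟩ := exists_forall_algEquiv_eq_carlitz hm g
      rw [hc v hv, hc _ (carlitz_algEquiv_eq_zero hv g'), carlitz_algEquiv]
    have hfix {v : Kbar Fq} (hv : carlitz Fq m v = 0) (hhv : h v = v) : v = 0 := by
      by_contra hv0
      obtain ⟨c, rfl⟩ := exists_carlitz_eq hm hv0 hv hw
      exact hhw (by rw [carlitz_algEquiv, hhv])
    have hhu' : h⁻¹ u = u := by
      apply h.injective
      rw [← AlgEquiv.mul_apply, mul_inv_cancel, AlgEquiv.one_apply, hhu]
    have hstab {v : Kbar Fq} (hv : v ∈ S) : h v ∈ S := by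
      obtain ⟨s, hs, hst⟩ := hv
      refine ⟨h * s * h⁻¹, ?_, fun w hw => ?_⟩
      · rw [AlgEquiv.mul_apply, AlgEquiv.mul_apply, hhu', hs, map_add, hhu]
      · rw [AlgEquiv.mul_apply, AlgEquiv.mul_apply, hst _ (carlitz_algEquiv_eq_zero hw _),
          ← AlgEquiv.mul_apply, mul_inv_cancel, AlgEquiv.one_apply]
    have hv : carlitz Fq m (g u - u) = 0 := carlitz_algEquiv_sub_self hu g
    have hcommutator : (g u - u) - h (g u - u) ∈ S := by
      have hgv : g (g⁻¹ u) = u := g.apply_symm_apply u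
      refine ⟨g * h * g⁻¹ * h⁻¹, ?_, fun w hw => ?_⟩
      · have hv' : carlitz Fq m (g⁻¹ u - u) = 0 := carlitz_algEquiv_sub_self hu g⁻¹
        have hg' : g⁻¹ u = u + (g⁻¹ u - u) := (add_sub_cancel _ _).symm
        rw [AlgEquiv.mul_apply, AlgEquiv.mul_apply, AlgEquiv.mul_apply, hhu', hg', map_add, hhu,
          map_add, hcomm g h hv', map_sub, hgv, ← neg_sub (g u) u, map_neg]
        ring
      · rw [AlgEquiv.mul_apply, AlgEquiv.mul_apply,
          hcomm g⁻¹ h⁻¹ hw, AlgEquiv.mul_apply]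
        rw [show h (h⁻¹ (g⁻¹ w)) = g⁻¹ w from h.apply_symm_apply _]
        exact g.apply_symm_apply w
    let φ : S → S := fun s => ⟨s - h s, sub_mem s.2 (hstab s.2)⟩
    have hφ : Function.Injective φ := fun s t hst => by
      have hst' : (s : Kbar Fq) - h s = t - h t := congrArg Subtype.val hst
      refine Subtype.ext (sub_eq_zero.mp (hfix (hS _ (sub_mem s.2 t.2)) ?_))
      rw [map_sub]
      linear_combination -hst'
    obtain ⟨s, hs⟩ := Finite.surjective_of_injective hφ ⟨_, hcommutator⟩
    have hs' : (s : Kbar Fq) - h s = (g u - u) - h (g u - u) := congrArg Subtype.val hs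
    have : (s : Kbar Fq) - (g u - u) = 0 := by
      refine hfix (by rw [carlitz_sub, hS s s.2, hv, sub_zero]) ?_
      rw [map_sub]
      linear_combination -hs'
    exact sub_eq_zero.mp this ▸ s.2
  have horb : MulAction.orbit G u = (u + ·) '' (S : Set (Kbar Fq)) := by
    ext v
    constructor
    · rintro ⟨g, rfl⟩
      exact ⟨_, horb_mem g, add_sub_cancel _ _⟩
    · rintro ⟨v, ⟨g, hg, -⟩, rfl⟩
      exact ⟨g, hg⟩
  rw [← ncard_orbit_algEquiv hsep, horb, Set.ncard_image_of_injective _ (add_right_injective u)]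
  have : CharP (Kbar Fq) p := charP_of_injective_algebraMap (algebraMap Fq (Kbar Fq)).injective p
  let := ZMod.algebra (Kbar Fq) p
  have : Finite (AddSubgroup.toZModSubmodule p S) := hSfin
  have hcard := Module.natCard_eq_pow_finrank (K := ZMod p) (V := AddSubgroup.toZModSubmodule p S)
  rw [Nat.card_zmod] at hcard
  exact ⟨_, hcard⟩

end Degree

theorem IsPureC.mono {E K L M : IntermediateField (RatFunc Fq) (Kbar Fq)}
    (h : IsPureC Fq E M) (hEK : E ≤ K) (hLM : L ≤ M) : IsPureC Fq K L :=
  fun m hm u hu hmu => hEK (h m hm u (hLM hu) hmu)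

/-- In a pure extension, adjoining an element of `DrinT` has `p`-power degree. -/
theorem IsPureC.exists_finrank_adjoin_eq_pow (p : ℕ) [Fact p.Prime] [CharP Fq p]
    {K L : IntermediateField (RatFunc Fq) (Kbar Fq)} (hKL : K ≤ L) (hpure : IsPureC Fq K L)
    {m : Fq[X]} (hm : m ≠ 0) {u : Kbar Fq} (huL : u ∈ L) (hu : carlitz Fq m u ∈ K) :
    ∃ j : ℕ, Module.finrank K K⟮u⟯ = p ^ j := by
  induction m using WfDvdMonoid.induction_on_irreducible generalizing u with
  | zero => exact absurd rfl hm
  | unit m hm' =>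
    obtain ⟨b, hb⟩ := hm'.exists_left_inv
    have huK : u ∈ K := by
      rw [← carlitz_one u, ← hb, carlitz_mul]
      exact carlitz_mem K b hu
    refine ⟨0, ?_⟩
    rw [pow_zero, finrank_adjoin_simple_eq_one_iff]
    exact mem_bot.mpr ⟨⟨u, huK⟩, rfl⟩
  | mul a i ha hi ih =>
    rw [mul_comm, carlitz_mul] at hu
    have hwL := carlitz_mem L i huL
    obtain ⟨j, hj⟩ := ih ha hwL hu
    let K' : IntermediateField (RatFunc Fq) (Kbar Fq) :=
      K⟮carlitz Fq i u⟯.restrictScalars (RatFunc Fq)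
    obtain ⟨hKK', hwK'⟩ := restrictScalars_adjoin_simple_le_iff.mp (le_refl K')
    have hK'L : K' ≤ L := restrictScalars_adjoin_simple_le_iff.mpr ⟨hKL, hwL⟩
    have hK'u : K'⟮u⟯.restrictScalars (RatFunc Fq) ≤ L :=
      restrictScalars_adjoin_simple_le_iff.mpr ⟨hK'L, huL⟩
    obtain ⟨j', hj'⟩ := _root_.exists_finrank_adjoin_eq_pow p hi hwK' fun v hv hmv =>
      hKK' (hpure i hi v (hK'u hv) hmv)
    have heq : K⟮u⟯.restrictScalars (RatFunc Fq) = K'⟮u⟯.restrictScalars (RatFunc Fq) := by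
      obtain ⟨h₁, h₂⟩ := restrictScalars_adjoin_simple_le_iff.mp
        (le_refl (K⟮u⟯.restrictScalars (RatFunc Fq)))
      obtain ⟨h₃, h₄⟩ := restrictScalars_adjoin_simple_le_iff.mp
        (le_refl (K'⟮u⟯.restrictScalars (RatFunc Fq)))
      refine le_antisymm (restrictScalars_adjoin_simple_le_iff.mpr ⟨hKK'.trans h₃, h₄⟩)
        (restrictScalars_adjoin_simple_le_iff.mpr
          ⟨restrictScalars_adjoin_simple_le_iff.mpr ⟨h₁, carlitz_mem _ i h₂⟩, h₂⟩)
    refine ⟨j + j', ?_⟩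
    rw [← relfinrank_restrictScalars_adjoin, heq, ← relfinrank_mul_relfinrank hKK'
      (restrictScalars_adjoin_simple_le_iff.mp le_rfl).1, relfinrank_restrictScalars_adjoin,
      relfinrank_restrictScalars_adjoin, hj, hj', pow_add]

/-- A finite pure extension generated by elements of `DrinT` has `p`-power degree. -/
theorem IsPureC.exists_relfinrank_eq_pow (p : ℕ) [Fact p.Prime] [CharP Fq p]
    {K L : IntermediateField (RatFunc Fq) (Kbar Fq)} (hKL : K ≤ L) (hpure : IsPureC Fq K L)
    {Y : Set (Kbar Fq)} (hY : Y ⊆ DrinT Fq K L)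
    (hgen : L = adjoin (RatFunc Fq) ((K : Set (Kbar Fq)) ∪ Y)) (hfin : relfinrank K L ≠ 0) :
    ∃ j : ℕ, relfinrank K L = p ^ j := by
  induction hn : relfinrank K L using Nat.strong_induction_on generalizing K with
  | _ n ih =>
  by_cases hYK : Y ⊆ K
  · refine ⟨0, ?_⟩
    rw [← hn, pow_zero, relfinrank_eq_one_iff, hgen, adjoin_le_iff]
    exact Set.union_subset subset_rfl hYK
  obtain ⟨u, huY, huK⟩ := Set.not_subset.mp hYK
  obtain ⟨huL, m, hm, hu⟩ := hY huY
  obtain ⟨j, hj⟩ := hpure.exists_finrank_adjoin_eq_pow p hKL hm huL hu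
  let K' : IntermediateField (RatFunc Fq) (Kbar Fq) := K⟮u⟯.restrictScalars (RatFunc Fq)
  obtain ⟨hKK', huK'⟩ := restrictScalars_adjoin_simple_le_iff.mp (le_refl K')
  have hK'L : K' ≤ L := restrictScalars_adjoin_simple_le_iff.mpr ⟨hKL, huL⟩
  have hmul := relfinrank_mul_relfinrank hKK' hK'L
  have hj0 : relfinrank K K' = p ^ j := (relfinrank_restrictScalars_adjoin K u).trans hj
  have hj1 : relfinrank K K' ≠ 1 := fun h => huK (relfinrank_eq_one_iff.mp h huK')
  have hK'0 : relfinrank K' L ≠ 0 := fun h => hfin (by rw [← hmul, h, mul_zero])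
  have hKK'0 : relfinrank K K' ≠ 0 := fun h => hfin (by rw [← hmul, h, zero_mul])
  obtain ⟨j', hj'⟩ := ih (relfinrank K' L)
    (by rw [← hn, ← hmul]; exact lt_mul_left (by omega) (by omega))
    hK'L (hpure.mono hKK' le_rfl)
    (fun v hv => ⟨(hY hv).1, (hY hv).2.imp fun a ha => ⟨ha.1, hKK' ha.2⟩⟩)
    (le_antisymm
      (hgen.le.trans (adjoin.mono _ _ _ (Set.union_subset_union_left Y hKK')))
      (adjoin_le_iff.mpr (Set.union_subset hK'L fun v hv => (hY hv).1)))
    hK'0 rfl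
  exact ⟨j + j', by rw [← hn, ← hmul, hj0, hj', pow_add]⟩

/-- A finite extension of `p`-power degree is pure. -/
theorem isPureC_of_relfinrank_eq_pow (p : ℕ) [Fact p.Prime] [CharP Fq p]
    {K L : IntermediateField (RatFunc Fq) (Kbar Fq)} (hKL : K ≤ L) {n : ℕ}
    (hn : relfinrank K L = p ^ n) : IsPureC Fq K L := by
  intro m hm u huL hu
  have hK'L : K⟮u⟯.restrictScalars (RatFunc Fq) ≤ L :=
    restrictScalars_adjoin_simple_le_iff.mpr ⟨hKL, huL⟩
  have hdvd : Module.finrank K K⟮u⟯ ∣ p ^ n := by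
    rw [← relfinrank_restrictScalars_adjoin, ← hn, ← relfinrank_mul_relfinrank
      (restrictScalars_adjoin_simple_le_iff.mp le_rfl).1 hK'L]
    exact dvd_mul_right _ _
  obtain ⟨j, -, hj⟩ := (Nat.dvd_prime_pow Fact.out).mp hdvd
  exact mem_of_finrank_adjoin_eq_pow p hm hu hj

variable (Fq)

/-- A finite extension `L/E` (with `k ⊆ E ⊆ L ⊆ k̄`) is cyclotomic
coradical if and only if it is separable, radical and `[L : E] = p^m` for some `m ∈ ℕ`,
where `p = char k`. -/
theorem isCycloCoradical_iff (p : ℕ) [Fact p.Prime] [CharP Fq p]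
    (E L : IntermediateField (RatFunc Fq) (Kbar Fq)) (hEL : E ≤ L)
    (hfin : FiniteDimensional E (extendScalars hEL)) :
    IsCycloCoradicalC Fq E L ↔
      (IsSeparableC Fq E L ∧ IsRadicalC Fq E L ∧
        ∃ m : ℕ, Module.finrank E (extendScalars hEL) = p ^ m) := by
  rw [← relfinrank_eq_finrank_of_le hEL]
  constructor
  · rintro ⟨⟨Y, hY, hgen⟩, hsep, hpure⟩
    refine ⟨hsep, ⟨Y, hY, hgen⟩, hpure.exists_relfinrank_eq_pow p hEL hY hgen ?_⟩
    rw [relfinrank_eq_finrank_of_le hEL]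
    exact Module.finrank_pos.ne'
  · rintro ⟨hsep, hrad, n, hn⟩
    exact ⟨hrad, hsep, isPureC_of_relfinrank_eq_pow p hEL hn⟩

end
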